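/- Let 0 < p < 1/2, let N ∈ ℕ, let a be a p-atom with support I_N, and let n be a positive integer with n > M_N. There is a constant c > 0 (depending only on sup_n m_n) such that for all 0 ≤ i < j ≤ N with ⟨n⟩ ≤ j and all x ∈ I_N^{i,j}: ( M_{⟨n⟩}^{1/p−2} / M_{|n|}^{1/p−2} ) · |σ_n a(x)| ≤ c · M_{⟨n⟩}^{1/p−2} M_i M_j. -/

import Mathlib

open MeasureTheory Filter
open scoped ENNReal NNReal Real BigOperators

noncomputable section

namespace Vilenkin

instance (k : ℕ) : MeasurableSpace (ZMod k) := ⊤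

/-- The Vilenkin group: the product of the cyclic groups `ZMod (m n)`. -/
abbrev G (m : ℕ → ℕ) : Type := ∀ n : ℕ, ZMod (m n)

variable (m : ℕ → ℕ)

/-- The generalized powers `M_0 = 1`, `M_{n+1} = m_n M_n`. -/
def Mprod : ℕ → ℕ
  | 0 => 1
  | n + 1 => m n * Mprod n

/-- The `k`-th digit of `n` in the base-`M` expansion `n = Σ_k n_k M_k`. -/
def digit (n k : ℕ) : ℕ := (n / Mprod m k) % m k

/-- `⟨n⟩`, the smallest index of a nonzero digit. -/
def lowIdx (n : ℕ) : ℕ := sInf {j | digit m n j ≠ 0}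

/-- `|n|`, the largest index of a nonzero digit. -/
def highIdx (n : ℕ) : ℕ := sSup {j | digit m n j ≠ 0}

/-- Generalized Rademacher functions `r_k(x) = exp(2πi x_k / m_k)`. -/
def rad (k : ℕ) (x : G m) : ℂ :=
  Complex.exp (2 * Real.pi * Complex.I * ((x k).val : ℂ) / (m k : ℂ))

/-- The Vilenkin system `ψ_n = ∏_k r_k^{n_k}`. -/
def psi (n : ℕ) (x : G m) : ℂ :=
  ∏ k ∈ Finset.range (n + 1), rad m k x ^ digit m n k

/-- Dirichlet kernels `D_n = Σ_{k<n} ψ_k`. -/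
def Dker (n : ℕ) (x : G m) : ℂ := ∑ k ∈ Finset.range n, psi m k x

/-- Fejér kernels `K_n = (1/n) Σ_{k<n} D_k`. -/
def Kker (n : ℕ) (x : G m) : ℂ := (n : ℂ)⁻¹ * ∑ k ∈ Finset.range n, Dker m k x

/-- The cylinder `I_n(x)`. -/
def cylinder (n : ℕ) (x : G m) : Set (G m) := {y | ∀ j, j < n → y j = x j}

/-- `e_t`: the element with `t`-th coordinate `1` and all others `0`. -/
def eVec (t : ℕ) : G m := fun j => if j = t then 1 else 0

/-- The filtration `F_n` generated by the cylinders of level `n`. -/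
def filtr (n : ℕ) : MeasurableSpace (G m) :=
  MeasurableSpace.comap (fun x (j : Fin n) => x j.val) inferInstance

/-- The normalized Haar measure on `G_m`: the probability measure giving each cylinder
`I_n(x)` measure `1/M_n`. -/
def IsVilenkinMeasure (μ : Measure (G m)) : Prop :=
  IsProbabilityMeasure μ ∧ ∀ n x, μ (cylinder m n x) = (Mprod m n : ℝ≥0∞)⁻¹

/-- Martingales with respect to the filtration `(F_n)`. -/
def IsMartingale (μ : Measure (G m)) (f : ℕ → G m → ℂ) : Prop :=
  (∀ n, Integrable (f n) μ) ∧
  (∀ n, Measurable[filtr m n] (f n)) ∧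
  (∀ n, ∀ s : Set (G m), MeasurableSet[filtr m n] s →
    ∫ x in s, f (n + 1) x ∂μ = ∫ x in s, f n x ∂μ)

/-- The maximal function `f* = sup_n |f^{(n)}|` (with values in `ℝ≥0∞`). -/
def maximalFn (f : ℕ → G m → ℂ) (x : G m) : ℝ≥0∞ := ⨆ n, (‖f n x‖₊ : ℝ≥0∞)

/-- The martingale Hardy space quasi-norm `‖f‖_{H_p} = ‖f*‖_{L_p}`. -/
def hardyNorm (p : ℝ) (μ : Measure (G m)) (f : ℕ → G m → ℂ) : ℝ≥0∞ :=
  (∫⁻ x, maximalFn m f x ^ p ∂μ) ^ (1 / p)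

/-- Vilenkin-Fourier coefficients of an integrable function. -/
def fourierCoeff (μ : Measure (G m)) (g : G m → ℂ) (k : ℕ) : ℂ :=
  ∫ x, g x * (starRingEnd ℂ) (psi m k x) ∂μ

/-- Partial sums `S_n g` of the Vilenkin-Fourier series of a function. -/
def SFun (μ : Measure (G m)) (g : G m → ℂ) (n : ℕ) (x : G m) : ℂ :=
  ∑ k ∈ Finset.range n, fourierCoeff m μ g k * psi m k x

/-- Fejér means `σ_n g` of a function. -/
def sigmaFun (μ : Measure (G m)) (g : G m → ℂ) (n : ℕ) (x : G m) : ℂ :=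
  (n : ℂ)⁻¹ * ∑ k ∈ Finset.range n, SFun m μ g k x

/-- Vilenkin-Fourier coefficients of a martingale:
`f̂(i) = lim_k ∫ f^{(k)} ψ̄_i dμ`. -/
def martCoeff (μ : Measure (G m)) (f : ℕ → G m → ℂ) (i : ℕ) : ℂ :=
  limUnder atTop fun k => ∫ x, f k x * (starRingEnd ℂ) (psi m i x) ∂μ

/-- Partial sums `S_n f` of the Vilenkin-Fourier series of a martingale. -/
def SMart (μ : Measure (G m)) (f : ℕ → G m → ℂ) (n : ℕ) (x : G m) : ℂ :=
  ∑ k ∈ Finset.range n, martCoeff m μ f k * psi m k x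

/-- Fejér means `σ_n f` of a martingale. -/
def sigmaMart (μ : Measure (G m)) (f : ℕ → G m → ℂ) (n : ℕ) (x : G m) : ℂ :=
  (n : ℂ)⁻¹ * ∑ k ∈ Finset.range n, SMart m μ f k x

/-- The weak `L_p` quasi-norm `‖g‖_{L_{p,∞}} = (sup_λ λ^p μ(|g|>λ))^{1/p}`. -/
def weakNorm (p : ℝ) (μ : Measure (G m)) (g : G m → ℂ) : ℝ≥0∞ :=
  (⨆ lam : ℝ≥0, (lam : ℝ≥0∞) ^ p * μ {x | (lam : ℝ) < ‖g x‖}) ^ (1 / p)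

/-- A `p`-atom with prescribed support interval `I_N(x₀)`. -/
def IsPAtomAt (p : ℝ) (μ : Measure (G m)) (N : ℕ) (x₀ : G m) (a : G m → ℂ) : Prop :=
  Measurable a ∧ Function.support a ⊆ cylinder m N x₀ ∧
    (∫ x in cylinder m N x₀, a x ∂μ) = 0 ∧
    eLpNorm a ⊤ μ ≤ μ (cylinder m N x₀) ^ (-(1 / p))

/-- A `p`-atom. -/
def IsPAtom (p : ℝ) (μ : Measure (G m)) (a : G m → ℂ) : Prop :=
  ∃ N x₀, IsPAtomAt m p μ N x₀ a

/-- The sets `I_N^{i,j}` for `i < j ≤ N`. -/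
def IsetIJ (N i j : ℕ) : Set (G m) :=
  if j < N then
    {x | (∀ l, l < i → x l = 0) ∧ x i ≠ 0 ∧ (∀ l, i < l → l < j → x l = 0) ∧ x j ≠ 0}
  else
    {x | (∀ l, l < i → x l = 0) ∧ x i ≠ 0 ∧ (∀ l, i < l → l < N → x l = 0)}

/-! ### Generalized powers and digits -/

lemma Mprod_pos {m : ℕ → ℕ} (hm : ∀ n, 2 ≤ m n) (k : ℕ) : 0 < Mprod m k := by
  induction k with
  | zero => simp [Mprod]
  | succ k ih => exact Nat.mul_pos (by have := hm k; omega) ih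

lemma Mprod_dvd_Mprod (m : ℕ → ℕ) {k l : ℕ} (h : k ≤ l) : Mprod m k ∣ Mprod m l := by
  induction l, h using Nat.le_induction with
  | base => exact dvd_rfl
  | succ l _ ih => exact ih.mul_left _

lemma Mprod_mono {m : ℕ → ℕ} (hm : ∀ n, 2 ≤ m n) : Monotone (Mprod m) :=
  fun _ _ h => Nat.le_of_dvd (Mprod_pos hm _) (Mprod_dvd_Mprod m h)

lemma lt_Mprod {m : ℕ → ℕ} (hm : ∀ n, 2 ≤ m n) (k : ℕ) : k < Mprod m k := by
  induction k with
  | zero => simp [Mprod]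
  | succ k ih =>
    have : 2 * Mprod m k ≤ Mprod m (k + 1) := Nat.mul_le_mul_right _ (hm k)
    omega

lemma digit_eq_zero_of_lt {m : ℕ → ℕ} {n k : ℕ} (h : n < Mprod m k) : digit m n k = 0 := by
  simp [digit, Nat.div_eq_of_lt h]

lemma digit_Mprod_mul_of_lt {m : ℕ → ℕ} (hm : ∀ n, 2 ≤ m n) {k l : ℕ} (h : l < k) (q : ℕ) :
    digit m (Mprod m k * q) l = 0 := by
  obtain ⟨t, ht⟩ := Mprod_dvd_Mprod m (Nat.succ_le_of_lt h)
  have e : Mprod m k * q = Mprod m l * (m l * (t * q)) := by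
    rw [ht]; simp only [Mprod]; ring
  simp [digit, e, Nat.mul_div_right _ (Mprod_pos hm l)]

lemma digit_Mprod_mul_add {m : ℕ → ℕ} (hm : ∀ n, 2 ≤ m n) {k s : ℕ} (q : ℕ)
    (hs : s < Mprod m k) (l : ℕ) :
    digit m (Mprod m k * q + s) l = digit m (Mprod m k * q) l + digit m s l := by
  rcases lt_or_ge l k with h | h
  · obtain ⟨t, ht⟩ := Mprod_dvd_Mprod m (Nat.succ_le_of_lt h)
    have e : Mprod m k * q = Mprod m l * (m l * (t * q)) := by
      rw [ht]; simp only [Mprod]; ring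
    simp [digit, e, Nat.mul_add_div (Mprod_pos hm l), Nat.mul_div_right _ (Mprod_pos hm l)]
  · obtain ⟨t, ht⟩ := Mprod_dvd_Mprod m h
    rw [digit_eq_zero_of_lt (hs.trans_le (Mprod_mono hm h))]
    simp [digit, ht, ← Nat.div_div_eq_div_mul, Nat.mul_add_div (Mprod_pos hm k),
      Nat.mul_div_right _ (Mprod_pos hm k), Nat.div_eq_of_lt hs]

lemma le_highIdx {m : ℕ → ℕ} (hm : ∀ n, 2 ≤ m n) {N n : ℕ} (h : Mprod m N ≤ n) :
    N ≤ highIdx m n := by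
  have hb : BddAbove {j | digit m n j ≠ 0} := by
    refine ⟨n, fun j hj => ?_⟩
    by_contra! hlt
    exact hj (digit_eq_zero_of_lt (hlt.trans (lt_Mprod hm j)))
  suffices ∃ j, N ≤ j ∧ digit m n j ≠ 0 by
    obtain ⟨j, hNj, hj⟩ := this
    exact hNj.trans (le_csSup hb hj)
  by_contra! h0
  have hle : ∀ k, N ≤ k → Mprod m k ≤ n := by
    intro k hk
    induction k, hk using Nat.le_induction with
    | base => exact h
    | succ k hk ih =>
      have hd : m k ∣ n / Mprod m k := Nat.dvd_of_mod_eq_zero (h0 k hk)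
      have hle := Nat.le_of_dvd (Nat.div_pos ih (Mprod_pos hm k)) hd
      exact (Nat.le_div_iff_mul_le (Mprod_pos hm k)).1 hle
  have h1 := hle (max N n) (le_max_left _ _)
  have h2 := lt_Mprod hm (max N n)
  have h3 := le_max_right N n
  omega

/-! ### The Vilenkin system -/

lemma rad_eq_one {m : ℕ → ℕ} {k : ℕ} {x : G m} (h : x k = 0) : rad m k x = 1 := by
  simp [rad, h]

lemma rad_pow_eq_one {m : ℕ → ℕ} (hm : ∀ n, 2 ≤ m n) (k : ℕ) (x : G m) :
    rad m k x ^ m k = 1 := by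
  have h : (m k : ℂ) ≠ 0 := by have := hm k; exact_mod_cast (by omega : m k ≠ 0)
  rw [rad, ← Complex.exp_nat_mul, Complex.exp_eq_one_iff]
  exact ⟨(x k).val, by field_simp; push_cast; ring⟩

lemma norm_rad {m : ℕ → ℕ} (hm : ∀ n, 2 ≤ m n) (k : ℕ) (x : G m) : ‖rad m k x‖ = 1 :=
  Complex.norm_eq_one_of_pow_eq_one (rad_pow_eq_one hm k x) (by have := hm k; omega)

lemma rad_ne_one {m : ℕ → ℕ} (hm : ∀ n, 2 ≤ m n) {k : ℕ} {x : G m} (h : x k ≠ 0) :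
    rad m k x ≠ 1 := by
  have : NeZero (m k) := ⟨by have := hm k; omega⟩
  have hmk : (m k : ℂ) ≠ 0 := NeZero.ne _
  rw [rad, Ne, Complex.exp_eq_one_iff]
  rintro ⟨z, hz⟩
  have hpi : (2 * Real.pi * Complex.I : ℂ) ≠ 0 := Complex.two_pi_I_ne_zero
  have hval : ((x k).val : ℂ) = z * m k := by
    apply mul_left_cancel₀ hpi
    rw [div_eq_iff hmk] at hz
    rw [hz]; ring
  have hdvd : (m k : ℤ) ∣ ((x k).val : ℤ) := ⟨z, by rw [mul_comm]; exact_mod_cast hval⟩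
  have hlt := ZMod.val_lt (x k)
  have hpos : (x k).val ≠ 0 := by simpa using h
  exact absurd (Nat.le_of_dvd (by omega) (Int.natCast_dvd_natCast.1 hdvd)) (by omega)

lemma psi_eq_prod {m : ℕ → ℕ} (hm : ∀ n, 2 ≤ m n) {n K : ℕ} (h : n < Mprod m K) (x : G m) :
    psi m n x = ∏ k ∈ Finset.range K, rad m k x ^ digit m n k := by
  have key : ∀ L, n < Mprod m L → ∀ L', L ≤ L' →
      ∏ k ∈ Finset.range L, rad m k x ^ digit m n k =
        ∏ k ∈ Finset.range L', rad m k x ^ digit m n k := by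
    intro L hL L' hLL'
    refine Finset.prod_subset (Finset.range_mono hLL') fun k _ hk => ?_
    rw [Finset.mem_range, not_lt] at hk
    rw [digit_eq_zero_of_lt (hL.trans_le (Mprod_mono hm hk)), pow_zero]
  have h1 : n < Mprod m (n + 1) := (Nat.lt_succ_self n).trans (lt_Mprod hm _)
  rw [psi, key _ h1 _ (le_max_left (n + 1) K), key _ h _ (le_max_right (n + 1) K)]

lemma psi_Mprod_mul_add {m : ℕ → ℕ} (hm : ∀ n, 2 ≤ m n) {k s : ℕ} (q : ℕ)
    (hs : s < Mprod m k) (x : G m) :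
    psi m (Mprod m k * q + s) x = psi m (Mprod m k * q) x * psi m s x := by
  have h := lt_Mprod hm (Mprod m k * q + s)
  rw [psi_eq_prod hm h, psi_eq_prod hm (lt_of_le_of_lt (Nat.le_add_right _ _) h),
    psi_eq_prod hm (lt_of_le_of_lt (Nat.le_add_left _ _) h), ← Finset.prod_mul_distrib]
  exact Finset.prod_congr rfl fun l _ => by rw [digit_Mprod_mul_add hm q hs, pow_add]

lemma norm_psi {m : ℕ → ℕ} (hm : ∀ n, 2 ≤ m n) (n : ℕ) (x : G m) : ‖psi m n x‖ = 1 := by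
  simp [psi, norm_rad hm]

lemma psi_eq_one {m : ℕ → ℕ} (hm : ∀ n, 2 ≤ m n) {k s : ℕ} (hs : s < Mprod m k) {x : G m}
    (hx : ∀ l < k, x l = 0) : psi m s x = 1 := by
  rw [psi_eq_prod hm hs]
  exact Finset.prod_eq_one fun l hl => by rw [rad_eq_one (hx l (Finset.mem_range.1 hl)), one_pow]

lemma psi_Mprod_mul {m : ℕ → ℕ} (hm : ∀ n, 2 ≤ m n) {k d : ℕ} (hd : d < m k) (x : G m) :
    psi m (Mprod m k * d) x = rad m k x ^ d := by
  have h : Mprod m k * d < Mprod m (k + 1) := by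
    rw [Mprod, mul_comm]; exact Nat.mul_lt_mul_of_pos_right hd (Mprod_pos hm k)
  rw [psi_eq_prod hm h, Finset.prod_range_succ, Finset.prod_eq_one, one_mul]
  · rw [digit, Nat.mul_div_right _ (Mprod_pos hm k), Nat.mod_eq_of_lt hd]
  · intro l hl
    rw [digit_Mprod_mul_of_lt hm (Finset.mem_range.1 hl), pow_zero]

lemma psi_Mprod_mul_congr {m : ℕ → ℕ} (hm : ∀ n, 2 ≤ m n) (k q : ℕ) {x y : G m}
    (h : ∀ l, k ≤ l → x l = y l) : psi m (Mprod m k * q) x = psi m (Mprod m k * q) y := by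
  refine Finset.prod_congr rfl fun l _ => ?_
  rcases lt_or_ge l k with hl | hl
  · rw [digit_Mprod_mul_of_lt hm hl, pow_zero, pow_zero]
  · rw [rad, rad, h l hl]

/-! ### Dirichlet kernels and their sums -/

/-- Summation by blocks of length `M` of a sequence that factors on each block. -/
lemma sum_range_mul_add {M : ℕ} {g h f : ℕ → ℂ} (H : ∀ b, ∀ s < M, g (M * b + s) = h b * f s)
    (q : ℕ) {s : ℕ} (hs : s ≤ M) :
    ∑ u ∈ Finset.range (M * q + s), g u =
      (∑ b ∈ Finset.range q, h b) * ∑ u ∈ Finset.range M, f u +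
        h q * ∑ u ∈ Finset.range s, f u := by
  have block : ∀ b, ∀ t ≤ M, ∑ u ∈ Finset.range t, g (M * b + u) =
      h b * ∑ u ∈ Finset.range t, f u := fun b t ht => by
    rw [Finset.mul_sum]
    exact Finset.sum_congr rfl fun u hu => H b u ((Finset.mem_range.1 hu).trans_le ht)
  rw [Finset.sum_range_add, block q s hs]
  congr 1
  induction q with
  | zero => simp
  | succ q ih =>
    rw [Nat.mul_succ, Finset.sum_range_add, ih, block q M le_rfl, Finset.sum_range_succ, add_mul]

lemma Dker_Mprod_eq_zero {m : ℕ → ℕ} (hm : ∀ n, 2 ≤ m n) {k l : ℕ} {x : G m} (hl : l < k)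
    (hx : x l ≠ 0) : Dker m (Mprod m k) x = 0 := by
  induction k with
  | zero => omega
  | succ k ih =>
    have e : Dker m (Mprod m (k + 1)) x =
        (∑ b ∈ Finset.range (m k), psi m (Mprod m k * b) x) * Dker m (Mprod m k) x := by
      have := sum_range_mul_add (M := Mprod m k) (g := fun u => psi m u x)
        (h := fun b => psi m (Mprod m k * b) x) (f := fun u => psi m u x)
        (fun b s hs => psi_Mprod_mul_add hm b hs x) (m k) (Nat.zero_le _)
      simpa [Dker, Mprod, mul_comm] using this
    rw [e]
    rcases Nat.lt_succ_iff_lt_or_eq.1 hl with h | rfl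
    · rw [ih h, mul_zero]
    · rw [Finset.sum_congr rfl fun b hb => psi_Mprod_mul hm (Finset.mem_range.1 hb) x,
        geom_sum_eq (rad_ne_one hm hx), rad_pow_eq_one hm]
      simp

lemma norm_Dker_le {m : ℕ → ℕ} (hm : ∀ n, 2 ≤ m n) (n : ℕ) (x : G m) : ‖Dker m n x‖ ≤ n := by
  refine (norm_sum_le _ _).trans ?_
  simp [norm_psi hm]

lemma Dker_Mprod_mul_add {m : ℕ → ℕ} (hm : ∀ n, 2 ≤ m n) {k l : ℕ} {x : G m} (hl : l < k)
    (hx : x l ≠ 0) (q : ℕ) {s : ℕ} (hs : s ≤ Mprod m k) :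
    Dker m (Mprod m k * q + s) x = psi m (Mprod m k * q) x * Dker m s x := by
  have := sum_range_mul_add (M := Mprod m k) (g := fun u => psi m u x)
    (h := fun b => psi m (Mprod m k * b) x) (f := fun u => psi m u x)
    (fun b s hs => psi_Mprod_mul_add hm b hs x) q hs
  have h0 := Dker_Mprod_eq_zero hm hl hx
  rw [Dker] at h0
  rw [Dker, Dker, this, h0, mul_zero, zero_add]

lemma norm_Dker_le_Mprod {m : ℕ → ℕ} (hm : ∀ n, 2 ≤ m n) {k l : ℕ} {x : G m} (hl : l < k)
    (hx : x l ≠ 0) (n : ℕ) : ‖Dker m n x‖ ≤ Mprod m k := by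
  have hlt := Nat.mod_lt n (Mprod_pos hm k)
  rw [← Nat.div_add_mod n (Mprod m k), Dker_Mprod_mul_add hm hl hx _ hlt.le, norm_mul,
    norm_psi hm, one_mul]
  exact (norm_Dker_le hm _ x).trans (by exact_mod_cast hlt.le)

lemma norm_sum_Dker_le_sq {m : ℕ → ℕ} (hm : ∀ n, 2 ≤ m n) (n : ℕ) (x : G m) :
    ‖∑ u ∈ Finset.range n, Dker m u x‖ ≤ (n : ℝ) ^ 2 := by
  refine (norm_sum_le_of_le _ fun u hu => (norm_Dker_le hm u x).trans
    (Nat.cast_le.2 (Finset.mem_range.1 hu).le)).trans ?_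
  simp [sq]

/-- The Dirichlet kernel at a point of `I_k` is `M_k` times a sum over a coarser lattice. -/
lemma Dker_Mprod_mul {m : ℕ → ℕ} (hm : ∀ n, 2 ≤ m n) {k : ℕ} {x : G m} (hx : ∀ l < k, x l = 0)
    (q : ℕ) : Dker m (Mprod m k * q) x =
      (∑ b ∈ Finset.range q, psi m (Mprod m k * b) x) * Mprod m k := by
  have := sum_range_mul_add (M := Mprod m k) (g := fun u => psi m u x)
    (h := fun b => psi m (Mprod m k * b) x) (f := fun _ => 1)
    (fun b s hs => by rw [psi_Mprod_mul_add hm b hs x, psi_eq_one hm hs hx]) q (Nat.zero_le _)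
  simpa [Dker] using this

/-- Bound for `n K_n` on `I_N^{i,j}`. -/
lemma norm_sum_Dker_le {m : ℕ → ℕ} (hm : ∀ n, 2 ≤ m n) {N i j : ℕ} (hij : i < j) (hjN : j ≤ N)
    {x : G m} (hx : x ∈ IsetIJ m N i j) {r : ℕ} (hr : r ≤ Mprod m N) :
    ‖∑ u ∈ Finset.range r, Dker m u x‖ ≤ 2 * Mprod m (i + 1) * Mprod m (j + 1) := by
  have hi : x i ≠ 0 := by
    rw [IsetIJ] at hx; split_ifs at hx
    exacts [hx.2.1, hx.2.1]
  have hlow : ∀ l < i, x l = 0 := by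
    rw [IsetIJ] at hx; split_ifs at hx
    exacts [hx.1, hx.1]
  set M := Mprod m (i + 1) with hM
  have hMpos : (0 : ℝ) < M := by exact_mod_cast Mprod_pos hm (i + 1)
  have hMj : (M : ℝ) ≤ Mprod m (j + 1) := by exact_mod_cast Mprod_mono hm (by omega)
  have hmod := Nat.mod_lt r (Mprod_pos hm (i + 1))
  have hcoarse : ‖∑ b ∈ Finset.range (r / M), psi m (M * b) x‖ * M ≤ Mprod m (j + 1) := by
    set y : G m := Function.update x i 0 with hy
    have hy0 : ∀ l < i + 1, y l = 0 := by
      intro l hl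
      rcases Nat.lt_succ_iff_lt_or_eq.1 hl with h | rfl
      · rw [hy, Function.update_of_ne h.ne, hlow l h]
      · simp [hy]
    have hsum : ∑ b ∈ Finset.range (r / M), psi m (M * b) x =
        ∑ b ∈ Finset.range (r / M), psi m (M * b) y :=
      Finset.sum_congr rfl fun b _ => psi_Mprod_mul_congr hm _ _ fun l hl => by
        rw [hy, Function.update_of_ne (by omega)]
    have hD := congrArg norm (Dker_Mprod_mul hm hy0 (r / M))
    rw [norm_mul, Complex.norm_natCast] at hD
    rw [hsum, ← hD]
    rw [IsetIJ] at hx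
    split_ifs at hx with hj
    · refine norm_Dker_le_Mprod hm (Nat.lt_succ_self j) ?_ _
      rw [hy, Function.update_of_ne hij.ne']
      exact hx.2.2.2
    · obtain rfl : j = N := by omega
      refine (norm_Dker_le hm _ y).trans (Nat.cast_le.2 ?_)
      exact (Nat.mul_div_le _ _).trans (hr.trans (Mprod_mono hm (Nat.le_succ j)))
  have key := sum_range_mul_add (M := M) (g := fun u => Dker m u x)
    (h := fun b => psi m (M * b) x) (f := fun u => Dker m u x)
    (fun b s hs => Dker_Mprod_mul_add hm (Nat.lt_succ_self i) hi b hs.le) (r / M) hmod.le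
  rw [Nat.div_add_mod] at key
  rw [key]
  refine (norm_add_le _ _).trans ?_
  rw [norm_mul, norm_mul, norm_psi hm, one_mul]
  have h1 := norm_sum_Dker_le_sq hm M x
  have h2 := (norm_sum_Dker_le_sq hm (r % M) x).trans
    (pow_le_pow_left₀ (by positivity) (Nat.cast_le (α := ℝ) |>.2 hmod.le) 2)
  calc _ ≤ ‖∑ b ∈ Finset.range (r / M), psi m (M * b) x‖ * (M : ℝ) ^ 2 + (M : ℝ) ^ 2 := by gcongr
    _ = (‖∑ b ∈ Finset.range (r / M), psi m (M * b) x‖ * M) * M + M * M := by ring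
    _ ≤ Mprod m (j + 1) * M + M * Mprod m (j + 1) := by gcongr
    _ = 2 * M * Mprod m (j + 1) := by ring

/-! ### Fejér means of functions supported on `I_N` -/

lemma fourierCoeff_Mprod_mul_add {m : ℕ → ℕ} (hm : ∀ n, 2 ≤ m n) (μ : Measure (G m)) {N s : ℕ}
    {a : G m → ℂ} (ha : Function.support a ⊆ cylinder m N 0) (q : ℕ) (hs : s < Mprod m N) :
    fourierCoeff m μ a (Mprod m N * q + s) = fourierCoeff m μ a (Mprod m N * q) := by
  refine integral_congr_ae (Eventually.of_forall fun x => ?_)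
  by_cases hx : a x = 0
  · simp [hx]
  · simp only [psi_Mprod_mul_add hm q hs, psi_eq_one hm hs (ha hx), mul_one]

lemma SFun_Mprod_mul_add {m : ℕ → ℕ} (hm : ∀ n, 2 ≤ m n) (μ : Measure (G m)) {N : ℕ}
    {a : G m → ℂ} (ha : Function.support a ⊆ cylinder m N 0) {l : ℕ} (hl : l < N) {x : G m}
    (hx : x l ≠ 0) (q : ℕ) {s : ℕ} (hs : s ≤ Mprod m N) :
    SFun m μ a (Mprod m N * q + s) x =
      fourierCoeff m μ a (Mprod m N * q) * psi m (Mprod m N * q) x * Dker m s x := by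
  have := sum_range_mul_add (M := Mprod m N) (g := fun u => fourierCoeff m μ a u * psi m u x)
    (h := fun b => fourierCoeff m μ a (Mprod m N * b) * psi m (Mprod m N * b) x)
    (f := fun u => psi m u x)
    (fun b s hs => by
      rw [fourierCoeff_Mprod_mul_add hm μ ha b hs, psi_Mprod_mul_add hm b hs x, mul_assoc]) q hs
  have h0 := Dker_Mprod_eq_zero hm hl hx
  rw [Dker] at h0
  rw [SFun, Dker, this, h0, mul_zero, zero_add]

lemma norm_sigmaFun_le {m : ℕ → ℕ} (hm : ∀ n, 2 ≤ m n) (μ : Measure (G m)) {N : ℕ}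
    {a : G m → ℂ} (ha : Function.support a ⊆ cylinder m N 0) {l : ℕ} (hl : l < N) {x : G m}
    (hx : x l ≠ 0) {A C : ℝ} (hA : ∀ k, ‖fourierCoeff m μ a k‖ ≤ A)
    (hC : ∀ r ≤ Mprod m N, ‖∑ u ∈ Finset.range r, Dker m u x‖ ≤ C) {n : ℕ}
    (hn : Mprod m N ≤ n) : ‖sigmaFun m μ a n x‖ ≤ 2 * A * C / Mprod m N := by
  have hA0 : 0 ≤ A := (norm_nonneg _).trans (hA 0)
  have hC0 : 0 ≤ C := (norm_nonneg _).trans (hC 0 (Nat.zero_le _))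
  have hMpos := Mprod_pos hm N
  set M := Mprod m N with hM
  have hmod := Nat.mod_lt n hMpos
  have hterm : ∀ b, ‖fourierCoeff m μ a (M * b) * psi m (M * b) x‖ ≤ A := fun b => by
    rw [norm_mul, norm_psi hm, mul_one]; exact hA _
  have key := sum_range_mul_add (M := M) (g := fun u => SFun m μ a u x)
    (h := fun b => fourierCoeff m μ a (M * b) * psi m (M * b) x) (f := fun u => Dker m u x)
    (fun b s hs => SFun_Mprod_mul_add hm μ ha hl hx b hs.le) (n / M) hmod.le
  rw [Nat.div_add_mod] at key
  have hsum : ‖∑ b ∈ Finset.range (n / M), fourierCoeff m μ a (M * b) * psi m (M * b) x‖ ≤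
      (n / M : ℕ) * A := by
    refine (norm_sum_le_of_le _ fun b _ => hterm b).trans ?_
    simp
  have hq : (1 : ℝ) ≤ (n / M : ℕ) := by exact_mod_cast Nat.div_pos hn hMpos
  have hqn : (M : ℝ) * (n / M : ℕ) ≤ n := by exact_mod_cast Nat.mul_div_le n M
  have hMr : (0 : ℝ) < M := by exact_mod_cast hMpos
  have hnr : (0 : ℝ) < n := by exact_mod_cast hMpos.trans_le hn
  have hbound : ‖∑ u ∈ Finset.range n, SFun m μ a u x‖ ≤ 2 * (n / M : ℕ) * A * C := by
    rw [key]
    refine (norm_add_le _ _).trans ?_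
    rw [norm_mul, norm_mul]
    calc _ ≤ (n / M : ℕ) * A * C + A * C :=
          add_le_add (mul_le_mul hsum (hC M le_rfl) (norm_nonneg _) (by positivity))
            (mul_le_mul (hterm _) (hC _ hmod.le) (norm_nonneg _) hA0)
      _ ≤ (n / M : ℕ) * A * C + (n / M : ℕ) * (A * C) :=
          add_le_add le_rfl (le_mul_of_one_le_left (mul_nonneg hA0 hC0) hq)
      _ = _ := by ring
  rw [sigmaFun, norm_mul, norm_inv, Complex.norm_natCast, inv_mul_le_iff₀ hnr]
  calc _ ≤ 2 * (n / M : ℕ) * A * C := hbound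
    _ = (M * (n / M : ℕ)) * (2 * A * C / M) := by field_simp
    _ ≤ n * (2 * A * C / M) := by gcongr

lemma IsPAtomAt.norm_fourierCoeff_le {m : ℕ → ℕ} (hm : ∀ n, 2 ≤ m n) {μ : Measure (G m)}
    (hμ : IsVilenkinMeasure m μ) {p : ℝ} {N : ℕ} {a : G m → ℂ}
    (ha : IsPAtomAt m p μ N 0 a) (k : ℕ) :
    ‖fourierCoeff m μ a k‖ ≤ (Mprod m N : ℝ) ^ (1 / p) / Mprod m N := by
  obtain ⟨_, hsupp, -, hnorm⟩ := ha
  have hcyl := hμ.2 N 0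
  have hMpos : (0 : ℝ) < Mprod m N := by exact_mod_cast Mprod_pos hm N
  have hae : ∀ᵐ x ∂μ, ‖a x‖ ≤ (Mprod m N : ℝ) ^ (1 / p) := by
    have hconst : μ (cylinder m N 0) ^ (-(1 / p)) = ENNReal.ofReal ((Mprod m N : ℝ) ^ (1 / p)) := by
      rw [hcyl, ENNReal.inv_rpow, ENNReal.rpow_neg, inv_inv, ← ENNReal.ofReal_rpow_of_pos hMpos,
        ENNReal.ofReal_natCast]
    rw [hconst, eLpNorm_exponent_top] at hnorm
    filter_upwards [ae_le_eLpNormEssSup (f := a) (μ := μ)] with x hx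
    have := hx.trans hnorm
    rwa [← ofReal_norm, ENNReal.ofReal_le_ofReal_iff (by positivity)] at this
  have hset : fourierCoeff m μ a k =
      ∫ x in cylinder m N 0, a x * (starRingEnd ℂ) (psi m k x) ∂μ := by
    refine (setIntegral_eq_integral_of_forall_compl_eq_zero fun x hx => ?_).symm
    rw [Function.notMem_support.1 fun h => hx (hsupp h), zero_mul]
  have hfin : μ (cylinder m N 0) < ⊤ := by
    have := hμ.1
    exact measure_lt_top _ _
  have := norm_setIntegral_le_of_norm_le_const_ae (μ := μ)
    (f := fun x => a x * (starRingEnd ℂ) (psi m k x)) hfin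
    (C := (Mprod m N : ℝ) ^ (1 / p))
    (ae_restrict_of_ae (by
      filter_upwards [hae] with x hx
      simpa [norm_psi hm] using hx))
  rw [hset]
  refine this.trans_eq ?_
  rw [measureReal_def, hcyl, ENNReal.toReal_inv, ENNReal.toReal_natCast, ← div_eq_mul_inv]

/-- If `a` is a `p`-atom supported on `I_N`, `n > M_N`, `i < j ≤ N` and `⟨n⟩ ≤ j`, then
`(M_{⟨n⟩}^{1/p-2}/M_{|n|}^{1/p-2}) |σ_n a(x)| ≤ c M_{⟨n⟩}^{1/p-2} M_i M_j` on `I_N^{i,j}`. -/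
theorem fejer_mean_atom_bound
    (m : ℕ → ℕ) (hm : ∀ n, 2 ≤ m n) (hbdd : ∃ B, ∀ n, m n ≤ B)
    (μ : Measure (G m)) (hμ : IsVilenkinMeasure m μ) :
    ∃ c : ℝ, 0 < c ∧
      ∀ p : ℝ, 0 < p → p < 1 / 2 →
      ∀ (N : ℕ) (a : G m → ℂ), IsPAtomAt m p μ N 0 a →
      ∀ n : ℕ, Mprod m N < n →
      ∀ i j : ℕ, i < j → j ≤ N → lowIdx m n ≤ j →
      ∀ x ∈ IsetIJ m N i j,
        (Mprod m (lowIdx m n) : ℝ) ^ (1 / p - 2) / (Mprod m (highIdx m n) : ℝ) ^ (1 / p - 2) *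
            ‖sigmaFun m μ a n x‖ ≤
          c * (Mprod m (lowIdx m n) : ℝ) ^ (1 / p - 2) *
            (Mprod m i : ℝ) * (Mprod m j : ℝ) := by
  obtain ⟨B, hB⟩ := hbdd
  have hBpos : (0 : ℝ) < B := by
    have h0 := hm 0
    have h1 := hB 0
    exact_mod_cast (by omega : 0 < B)
  have hsucc : ∀ k, (Mprod m (k + 1) : ℝ) ≤ B * Mprod m k := fun k => by
    exact_mod_cast Nat.mul_le_mul_right _ (hB k)
  refine ⟨4 * (B : ℝ) ^ 2, by positivity, ?_⟩
  intro p hp hp2 N a ha n hn i j hij hjN _ x hx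
  have hi : x i ≠ 0 := by
    rw [IsetIJ] at hx; split_ifs at hx
    exacts [hx.2.1, hx.2.1]
  have hσ := norm_sigmaFun_le hm μ ha.2.1 (hij.trans_le hjN) hi (ha.norm_fourierCoeff_le hm hμ)
    (fun r hr => norm_sum_Dker_le hm hij hjN hx hr) hn.le
  have hMN : (0 : ℝ) < Mprod m N := by exact_mod_cast Mprod_pos hm N
  have hH : (0 : ℝ) < Mprod m (highIdx m n) := by exact_mod_cast Mprod_pos hm _
  have hexp : 0 ≤ 1 / p - 2 := by
    rw [sub_nonneg, le_div_iff₀ hp]; linarith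
  have hpow : (Mprod m N : ℝ) ^ (1 / p - 2) ≤ (Mprod m (highIdx m n) : ℝ) ^ (1 / p - 2) :=
    Real.rpow_le_rpow hMN.le (by exact_mod_cast Mprod_mono hm (le_highIdx hm hn.le)) hexp
  have hσ' : ‖sigmaFun m μ a n x‖ ≤
      (Mprod m (highIdx m n) : ℝ) ^ (1 / p - 2) * (4 * (B : ℝ) ^ 2 * Mprod m i * Mprod m j) := by
    calc _ ≤ _ := hσ
      _ = (Mprod m N : ℝ) ^ (1 / p - 2) * (4 * (Mprod m (i + 1) * Mprod m (j + 1))) := by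
          rw [Real.rpow_sub hMN, Real.rpow_two]; field_simp; ring
      _ ≤ (Mprod m (highIdx m n) : ℝ) ^ (1 / p - 2) *
          (4 * ((B * Mprod m i) * (B * Mprod m j))) := by
          gcongr <;> exact hsucc _
      _ = _ := by ring
  rw [div_mul_eq_mul_div, div_le_iff₀ (Real.rpow_pos_of_pos hH _)]
  calc _ ≤ (Mprod m (lowIdx m n) : ℝ) ^ (1 / p - 2) *
        ((Mprod m (highIdx m n) : ℝ) ^ (1 / p - 2) *
          (4 * (B : ℝ) ^ 2 * Mprod m i * Mprod m j)) := by gcongr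
    _ = _ := by ring

end Vilenkin
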